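/- (Coset structure of bad sections, characteristic p.) Let V ⊆ A^n_{F_q} be an irreducible variety of dimension ≥ 1 such that for some coordinate x_j, the projection x_j(V) has dimension 1. Let s be a regular function on V that is invertible (nowhere vanishing) on V, let u be a regular function on V, and let γ ≥ 0. Then the set G^{bad} := {g ∈ A_{≤γ} : u + g^p s vanishes identically on V} is either empty or a coset of the F_q-subspace {g ∈ A_{≤γ} : g vanishes identically on V} of A_{≤γ}, and this subspace has codimension ≥ γ + 1 in A_{≤γ}; consequently #G^{bad}/#A_{≤γ} ≤ q^{−(γ+1)}. -/

import Mathlib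

/-!
# Statement 13 (coset structure of bad sections in characteristic `p`)

`F` is the field with `q = p^a` elements, `A = F[x_1, …, x_n]`, and `A_{≤γ}`
the polynomials of total degree at most `γ`.  Varieties are modelled by their
sets of geometric points in `F̄^n`, where `F̄` is an algebraic closure of `F`:
`V ⊆ F̄^n` is Zariski closed (it is the zero locus of its vanishing ideal
`I(V) ⊆ A`) and irreducible (`I(V)` is prime), and for the coordinate `x_j`
the projection `x_j(V)` has dimension `1` (equivalently, it is an infinite
subset of `F̄`, i.e. no nonzero univariate polynomial in `x_j` vanishes on `V`).
`s` and `u` are regular functions on `V` (represented by polynomials), with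
`s` nowhere vanishing on `V`.

Conclusion: `G^bad = {g ∈ A_{≤γ} : u + g^p s ≡ 0 on V}` is empty or a coset of
the subspace `Z = {g ∈ A_{≤γ} : g ≡ 0 on V}`, `Z` has codimension `≥ γ + 1` in
`A_{≤γ}`, and `#G^bad / #A_{≤γ} ≤ q^{−(γ+1)}`.
-/

open MvPolynomial Function

noncomputable section

/-- `A = F[x_1, …, x_n]`. -/
abbrev Apoly (F : Type) [Field F] (n : ℕ) : Type := MvPolynomial (Fin n) F

/-- `A_{≤ γ}`, the polynomials of total degree at most `γ`. -/
abbrev Ale (F : Type) [Field F] (n γ : ℕ) : Type :=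
  ↥(restrictTotalDegree (Fin n) F γ)

/-- The vanishing ideal `I(V) ⊆ A` of a set `V` of geometric points of `𝔸^n`. -/
def vIdeal (F : Type) [Field F] (n : ℕ)
    (V : Set (Fin n → AlgebraicClosure F)) : Ideal (Apoly F n) :=
  ⨅ v ∈ V, RingHom.ker (aeval (R := F) v).toRingHom

/-- The subspace of `A_{≤ γ}` of polynomials vanishing identically on `V`. -/
def vanishSub (F : Type) [Field F] (n γ : ℕ)
    (V : Set (Fin n → AlgebraicClosure F)) : Submodule F (Ale F n γ) :=
  Submodule.comap (restrictTotalDegree (Fin n) F γ).subtype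
    (⨅ v ∈ V, LinearMap.ker (aeval (R := F) v).toLinearMap)

theorem mem_vanishSub {F : Type} [Field F] {n γ : ℕ} {V : Set (Fin n → AlgebraicClosure F)}
    {g : Ale F n γ} :
    g ∈ vanishSub F n γ V ↔ ∀ v ∈ V, aeval v (g : Apoly F n) = 0 := by
  simp [vanishSub]

theorem Polynomial.eq_zero_of_infinite_aeval_eq_zero {R L : Type*} [CommRing R] [CommRing L]
    [IsDomain L] [Algebra R L] [FaithfulSMul R L] (f : Polynomial R) {S : Set L}
    (hS : S.Infinite) (h : ∀ x ∈ S, Polynomial.aeval x f = 0) : f = 0 := by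
  refine (Polynomial.map_eq_zero_iff (FaithfulSMul.algebraMap_injective R L)).mp ?_
  refine Polynomial.eq_zero_of_infinite_isRoot _ (hS.mono fun x hx ↦ ?_)
  simpa [Polynomial.IsRoot, Polynomial.eval_map_algebraMap] using h x hx

/-- The powers `1, x_j, …, x_j ^ γ` stay independent modulo the polynomials vanishing on `V`,
as soon as `x_j` takes infinitely many values on `V`. -/
theorem succ_le_finrank_quotient_vanishSub {F : Type} [Field F] {n : ℕ} (γ : ℕ)
    {V : Set (Fin n → AlgebraicClosure F)} {j : Fin n}
    (hproj : ((fun v => v j) '' V).Infinite) :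
    γ + 1 ≤ Module.finrank F (Ale F n γ ⧸ vanishSub F n γ V) := by
  let b : Fin (γ + 1) → Ale F n γ := fun i ↦ ⟨X j ^ (i : ℕ), by
    rw [mem_restrictTotalDegree, totalDegree_X_pow]
    exact Nat.lt_succ_iff.mp i.is_lt⟩
  have hb : LinearIndependent F ((vanishSub F n γ V).mkQ ∘ b) := by
    rw [Fintype.linearIndependent_iff]
    intro c hc
    have hmem : ∑ i, c i • b i ∈ vanishSub F n γ V := by
      rw [← (vanishSub F n γ V).ker_mkQ, LinearMap.mem_ker]
      simpa using hc
    rw [mem_vanishSub] at hmem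
    have hf : ∑ i : Fin (γ + 1), Polynomial.monomial (i : ℕ) (c i) = 0 := by
      refine Polynomial.eq_zero_of_infinite_aeval_eq_zero _ hproj ?_
      rintro _ ⟨v, hv, rfl⟩
      simpa [b, Algebra.smul_def, Polynomial.aeval_monomial] using hmem v hv
    intro i
    simpa [Polynomial.finsetSum_coeff, Polynomial.coeff_monomial, Fin.val_inj] using
      congrArg (Polynomial.coeff · (i : ℕ)) hf
  simpa using hb.fintype_card_le_finrank

/-- In characteristic `p`, two `p`-th powers differ by a function vanishing where both
`u + g ^ p * s` and `u + g' ^ p * s` do and `s` is invertible. -/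
theorem add_pow_char_mul_eq_zero_iff {L : Type*} [CommRing L] [IsDomain L] {p : ℕ}
    [Fact p.Prime] [CharP L p] {s u x y : L} (hs : s ≠ 0) (hy : u + y ^ p * s = 0) :
    u + x ^ p * s = 0 ↔ x - y = 0 := by
  have key : u + x ^ p * s = (x - y) ^ p * s := by
    rw [sub_pow_char]
    linear_combination hy
  rw [key, mul_eq_zero, or_iff_left hs, pow_eq_zero_iff (Fact.out : p.Prime).ne_zero]

theorem Submodule.card_div_card_le_of_le_finrank_quotient {F M : Type*} [Field F] [Fintype F]
    [AddCommGroup M] [Module F M] [Module.Finite F M] (N : Submodule F M) {d : ℕ}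
    (hd : d ≤ Module.finrank F (M ⧸ N)) :
    (Nat.card N : ℝ) / Nat.card M ≤ ((Fintype.card F : ℝ) ^ d)⁻¹ := by
  have : Finite M := Module.finite_of_finite F
  have hN : (0 : ℝ) < Nat.card N := by exact_mod_cast Nat.card_pos
  have hF : (1 : ℝ) ≤ Fintype.card F := by exact_mod_cast Fintype.card_pos
  rw [N.card_eq_card_quotient_mul_card, Module.natCard_eq_pow_finrank (K := F) (V := M ⧸ N),
    Nat.card_eq_fintype_card (α := F)]
  push_cast
  rw [div_mul_cancel_left₀ hN.ne']
  gcongr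

theorem statement13
    -- `q` a power of a prime `p`, `F` the field with `q` elements
    (p a q : ℕ) (hp : p.Prime) (ha : 0 < a) (hq : q = p ^ a)
    (F : Type) [Field F] [Fintype F] (hF : Fintype.card F = q)
    (n : ℕ)
    -- `V ⊆ 𝔸^n` an irreducible (affine) variety …
    (V : Set (Fin n → AlgebraicClosure F))
    (hVclosed : V = {v | ∀ g ∈ vIdeal F n V, aeval v g = 0})
    (hVirred : (vIdeal F n V).IsPrime)
    -- … such that the projection `x_j(V)` has dimension `1`
    (j : Fin n) (hproj : ((fun v => v j) '' V).Infinite)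
    -- regular functions `s, u` on `V`, with `s` invertible on `V`
    (s u : Apoly F n)
    (hs : ∀ v ∈ V, aeval v s ≠ 0)
    (γ : ℕ) :
    -- conclusion, with `G^bad = {g ∈ A_{≤γ} : u + g^p s vanishes identically on V}`:
    -- (1) `G^bad` is empty or a coset of `Z = {g ∈ A_{≤γ} : g ≡ 0 on V}`;
    ({g : Ale F n γ | ∀ v ∈ V, aeval v (u + (g : Apoly F n) ^ p * s) = 0} = ∅ ∨
      ∃ g₀ ∈ {g : Ale F n γ | ∀ v ∈ V, aeval v (u + (g : Apoly F n) ^ p * s) = 0},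
        {g : Ale F n γ | ∀ v ∈ V, aeval v (u + (g : Apoly F n) ^ p * s) = 0} =
          {g : Ale F n γ | g - g₀ ∈ vanishSub F n γ V}) ∧
    -- (2) `Z` has codimension at least `γ + 1` in `A_{≤γ}`;
    γ + 1 ≤ Module.finrank F (Ale F n γ ⧸ vanishSub F n γ V) ∧
    -- (3) consequently `#G^bad / #A_{≤γ} ≤ q^{−(γ+1)}`
    (Nat.card {g : Ale F n γ | ∀ v ∈ V, aeval v (u + (g : Apoly F n) ^ p * s) = 0} : ℝ)
        / (Nat.card (Ale F n γ) : ℝ) ≤ ((q : ℝ) ^ (γ + 1))⁻¹ := by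
  have : Fact p.Prime := ⟨hp⟩
  have : CharP F p := charP_of_card_eq_prime_pow (hF.trans hq)
  have : CharP (AlgebraicClosure F) p :=
    charP_of_injective_algebraMap (algebraMap F (AlgebraicClosure F)).injective p
  have hcodim := succ_le_finrank_quotient_vanishSub γ hproj
  have hratio := (vanishSub F n γ V).card_div_card_le_of_le_finrank_quotient hcodim
  rw [hF] at hratio
  set G := {g : Ale F n γ | ∀ v ∈ V, aeval v (u + (g : Apoly F n) ^ p * s) = 0}
  have hcoset : ∀ g₀ ∈ G, G = {g : Ale F n γ | g - g₀ ∈ vanishSub F n γ V} := by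
    intro g₀ hg₀
    ext g
    refine Iff.trans ?_ (mem_vanishSub (g := g - g₀)).symm
    refine forall₂_congr fun v hv ↦ ?_
    have hy := hg₀ v hv
    simp only [map_add, map_mul, map_pow] at hy ⊢
    simpa using add_pow_char_mul_eq_zero_iff (hs v hv) hy
  rcases G.eq_empty_or_nonempty with hG | ⟨g₀, hg₀⟩
  · refine ⟨Or.inl hG, hcodim, ?_⟩
    rw [hG]
    simp
  · refine ⟨Or.inr ⟨g₀, hg₀, hcoset g₀ hg₀⟩, hcodim, ?_⟩
    have hcard : Nat.card G = Nat.card (vanishSub F n γ V) := by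
      rw [hcoset g₀ hg₀]
      exact Nat.card_congr ((Equiv.subRight g₀).subtypeEquiv fun _ ↦ Iff.rfl)
    rwa [hcard]

end
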